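/- In the algebra D~, for all m ∈ ℕ one has x2^{2m} * x1 = Σ_{k=0}^{m} (-1)^k * [-m]^[k] * x1 * x21^{k} * x2^{2(m-k)}, where [-m]^[k] is the raising factorial of the image of -m in k. -/

import Mathlib

/-!
The Hopf algebra `D~` (double of the super Jordan plane, bosonization stripped),
presented by generators x1, x2, u1, u2, g, g' (= g⁻¹), ζ and the relations
listed in the paper.  We realize it as `RingQuot` of the relation `Rel` on the
free algebra on 7 generators.
-/

namespace SuperJordanDouble

variable (k : Type) [Field k]

noncomputable def fx1 : FreeAlgebra k (Fin 7) := FreeAlgebra.ι k 0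
noncomputable def fx2 : FreeAlgebra k (Fin 7) := FreeAlgebra.ι k 1
noncomputable def fu1 : FreeAlgebra k (Fin 7) := FreeAlgebra.ι k 2
noncomputable def fu2 : FreeAlgebra k (Fin 7) := FreeAlgebra.ι k 3
noncomputable def fg  : FreeAlgebra k (Fin 7) := FreeAlgebra.ι k 4
noncomputable def fgi : FreeAlgebra k (Fin 7) := FreeAlgebra.ι k 5
noncomputable def fz  : FreeAlgebra k (Fin 7) := FreeAlgebra.ι k 6
noncomputable def fx21 : FreeAlgebra k (Fin 7) := fx1 k * fx2 k + fx2 k * fx1 k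
noncomputable def fu21 : FreeAlgebra k (Fin 7) := fu1 k * fu2 k + fu2 k * fu1 k

/-- The defining relations of `D~`. -/
inductive Rel : FreeAlgebra k (Fin 7) → FreeAlgebra k (Fin 7) → Prop
  | x1sq  : Rel (fx1 k * fx1 k) 0
  | x2x21 : Rel (fx2 k * fx21 k) (fx21 k * fx2 k + fx1 k * fx21 k)
  | u1sq  : Rel (fu1 k * fu1 k) 0
  | u2u21 : Rel (fu2 k * fu21 k) (fu21 k * fu2 k + fu1 k * fu21 k)
  | ggi   : Rel (fg k * fgi k) 1
  | gig   : Rel (fgi k * fg k) 1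
  | zg    : Rel (fz k * fg k) (fg k * fz k)
  | gx1   : Rel (fg k * fx1 k) (fx1 k * fg k)
  | gx2   : Rel (fg k * fx2 k) (fx2 k * fg k - fx1 k * fg k)
  | u1g   : Rel (fu1 k * fg k) (fg k * fu1 k)
  | u2g   : Rel (fu2 k * fg k) (fg k * fu2 k - fg k * fu1 k)
  | zx1   : Rel (fz k * fx1 k) (fx1 k * fz k + fx1 k)
  | zx2   : Rel (fz k * fx2 k) (fx2 k * fz k + fx2 k)
  | u1z   : Rel (fu1 k * fz k) (fz k * fu1 k + fu1 k)
  | u2z   : Rel (fu2 k * fz k) (fz k * fu2 k + fu2 k)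
  | u1x1  : Rel (fu1 k * fx1 k) (-(fx1 k * fu1 k))
  | u1x2  : Rel (fu1 k * fx2 k) (-(fx2 k * fu1 k) + 1 - fg k)
  | u2x1  : Rel (fu2 k * fx1 k) (-(fx1 k * fu2 k) + 1 - fg k + fx1 k * fu1 k)
  | u2x2  : Rel (fu2 k * fx2 k) (-(fx2 k * fu2 k) + fg k * fz k + fx2 k * fu1 k)

/-- The algebra `D~`. -/
abbrev tD := RingQuot (Rel k)

noncomputable def x1 : tD k := RingQuot.mkAlgHom k (Rel k) (fx1 k)
noncomputable def x2 : tD k := RingQuot.mkAlgHom k (Rel k) (fx2 k)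
noncomputable def u1 : tD k := RingQuot.mkAlgHom k (Rel k) (fu1 k)
noncomputable def u2 : tD k := RingQuot.mkAlgHom k (Rel k) (fu2 k)
noncomputable def g  : tD k := RingQuot.mkAlgHom k (Rel k) (fg k)
noncomputable def gi : tD k := RingQuot.mkAlgHom k (Rel k) (fgi k)
noncomputable def z  : tD k := RingQuot.mkAlgHom k (Rel k) (fz k)
noncomputable def x21 : tD k := x1 k * x2 k + x2 k * x1 k
noncomputable def u21 : tD k := u1 k * u2 k + u2 k * u1 k

/-- `g^n` for `n : ℤ`, where negative powers are interpreted using `g' = g⁻¹`. -/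
noncomputable def gpow (n : ℤ) : tD k :=
  if 0 ≤ n then g k ^ n.toNat else gi k ^ (-n).toNat

end SuperJordanDouble

open SuperJordanDouble

/-- The raising factorial `[a]^[n] = a(a+1)⋯(a+n-1)`. -/
def risingFactorial (k : Type) [Field k] (a : k) (n : ℕ) : k :=
  Finset.prod (Finset.range n) fun i => a + i

/-- If `c * t = t * c + t ^ 2`, then moving `c` past `t ^ n` adds `n * t ^ (n + 1)`. -/
lemma mul_pow_eq_of_mul_eq_add_sq {R : Type*} [Ring R] {c t : R}
    (h : c * t = t * c + t ^ 2) (n : ℕ) :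
    c * t ^ n = t ^ n * c + (n : R) * t ^ (n + 1) := by
  induction n with
  | zero => simp
  | succ n ih =>
    rw [pow_succ, ← mul_assoc, ih, add_mul, mul_assoc (t ^ n), h]
    push_cast
    noncomm_ring

lemma succ_descFactorial_succ_eq_add (m i : ℕ) :
    (m + 1).descFactorial (i + 1) =
      m.descFactorial (i + 1) + (i + 1) * m.descFactorial i := by
  rw [Nat.succ_descFactorial_succ, Nat.descFactorial_succ, ← add_mul]
  rcases le_or_gt i m with hi | hi
  · congr 1
    omega
  · simp [Nat.descFactorial_eq_zero_iff_lt.mpr hi]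

/-- The binomial theorem for elements of the Jordan plane. -/
lemma add_pow_of_mul_eq_add_sq {R : Type*} [Ring R] {c t : R}
    (h : c * t = t * c + t ^ 2) (m : ℕ) :
    (c + t) ^ m = ∑ i ∈ Finset.range (m + 1),
      (m.descFactorial i : R) * (t ^ i * c ^ (m - i)) := by
  induction m with
  | zero => simp
  | succ m ih =>
    have hterm : ∀ i ∈ Finset.range (m + 1),
        (c + t) * ((m.descFactorial i : R) * (t ^ i * c ^ (m - i))) =
          (m.descFactorial i : R) * (t ^ i * c ^ (m + 1 - i)) +
            (((i + 1) * m.descFactorial i : ℕ) : R) *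
              (t ^ (i + 1) * c ^ (m + 1 - (i + 1))) := by
      intro i hi
      have hi' : m + 1 - i = m - i + 1 := by
        have := Finset.mem_range.mp hi
        omega
      rw [← mul_assoc, ← (Nat.cast_commute (m.descFactorial i) (c + t)).eq, mul_assoc,
        ← mul_assoc (c + t), add_mul, mul_pow_eq_of_mul_eq_add_sq h, hi',
        Nat.add_sub_add_right, pow_succ' c, ← pow_succ' t, mul_comm (i + 1), Nat.cast_mul]
      push_cast
      noncomm_ring
    rw [pow_succ', ih, Finset.mul_sum, Finset.sum_congr rfl hterm, Finset.sum_add_distrib,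
      Finset.sum_range_succ' _ (m + 1)]
    simp_rw [succ_descFactorial_succ_eq_add, Nat.cast_add, add_mul]
    rw [Finset.sum_add_distrib, Finset.sum_range_succ' _ m,
      Finset.sum_range_succ (fun i => (m.descFactorial (i + 1) : R) * _) m]
    simp only [Nat.descFactorial_zero, Nat.descFactorial_of_lt (Nat.lt_succ_self m),
      Nat.cast_zero, zero_mul, add_zero]
    abel

lemma neg_one_pow_mul_risingFactorial_neg (k : Type) [Field k] (m i : ℕ) :
    (-1 : k) ^ i * risingFactorial k (-(m : k)) i = (m.descFactorial i : k) := by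
  induction i with
  | zero => simp [risingFactorial]
  | succ i ih =>
    have hs : risingFactorial k (-(m : k)) (i + 1) =
        risingFactorial k (-(m : k)) i * (-(m : k) + i) := Finset.prod_range_succ _ _
    rw [hs, pow_succ, mul_mul_mul_comm, ih, Nat.descFactorial_succ]
    rcases le_or_gt i m with hi | hi
    · push_cast [Nat.cast_sub hi]
      ring
    · simp [Nat.descFactorial_of_lt hi]

namespace SuperJordanDouble

variable (k : Type) [Field k]

lemma x1_mul_x1 : x1 k * x1 k = 0 := by
  simpa [x1] using RingQuot.mkAlgHom_rel k (Rel.x1sq (k := k))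

lemma x2_mul_x21 : x2 k * x21 k = x21 k * x2 k + x1 k * x21 k := by
  simpa [x1, x2, x21, fx21] using RingQuot.mkAlgHom_rel k (Rel.x2x21 (k := k))

lemma x2_mul_x1 : x2 k * x1 k = x21 k - x1 k * x2 k := by
  simp [x21]

lemma x2_sq_mul_x1 : x2 k ^ 2 * x1 k = x1 k * (x2 k ^ 2 + x21 k) := by
  rw [sq, mul_assoc, x2_mul_x1, mul_sub, x2_mul_x21, ← mul_assoc, x2_mul_x1]
  simp only [x21, sub_mul, mul_add, add_mul, mul_assoc]
  abel

lemma x2_sq_mul_x21 : x2 k ^ 2 * x21 k = x21 k * x2 k ^ 2 + x21 k ^ 2 := by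
  have h : x1 k * (x1 k * x21 k) = 0 := by rw [← mul_assoc, x1_mul_x1, zero_mul]
  rw [sq, mul_assoc, x2_mul_x21, mul_add, ← mul_assoc, ← mul_assoc, x2_mul_x21, x2_mul_x1,
    sub_mul, mul_assoc (x1 k), x2_mul_x21, mul_add, h]
  simp only [add_mul, mul_assoc, sq]
  abel

lemma x2_sq_pow_mul_x1 (m : ℕ) :
    (x2 k ^ 2) ^ m * x1 k = x1 k * (x2 k ^ 2 + x21 k) ^ m :=
  (SemiconjBy.pow_right (show SemiconjBy (x1 k) (x2 k ^ 2 + x21 k) (x2 k ^ 2) from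
    (x2_sq_mul_x1 k).symm) m).symm

end SuperJordanDouble

/-- In `D~`,
`x2^{2m} x1 = Σ_{k'=0}^{m} (-1)^{k'} [-m]^[k'] x1 x21^{k'} x2^{2(m-k')}`. -/
theorem superJordanDouble_x2_pow_mul_x1 (k : Type) [Field k]
    (hchar : (2 : k) ≠ 0) (m : ℕ) :
    x2 k ^ (2 * m) * x1 k =
      Finset.sum (Finset.range (m + 1)) fun i =>
        ((-1 : k) ^ i * risingFactorial k (-(m : k)) i) •
          (x1 k * x21 k ^ i * x2 k ^ (2 * (m - i))) := by
  rw [pow_mul, x2_sq_pow_mul_x1, add_pow_of_mul_eq_add_sq (x2_sq_mul_x21 k),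
    Finset.mul_sum]
  refine Finset.sum_congr rfl fun i _ => ?_
  rw [neg_one_pow_mul_risingFactorial_neg, Nat.cast_smul_eq_nsmul, nsmul_eq_mul, pow_mul,
    ← mul_assoc, ← (Nat.cast_commute (m.descFactorial i) (x1 k)).eq, mul_assoc, mul_assoc]
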